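/- arXiv:2110.10203 — 7 statements merged into one kernel-verified Lean document; each statement's English description precedes it below -/
import Mathlib

section
/- Let G and H be countable groups acting on infinite sets X and Y respectively. If the family of countable-configuration sets of the action of G on X equals that of the action of H on Y, i.e. Con_c(G↷X) = Con_c(H↷Y), then the families of finite configuration sets also coincide: Con(G↷X) = Con(H↷Y). -/
/-- A countable partition of `X` indexed by `ℕ`: nonempty, pairwise disjoint parts
covering `X`. -/
def IsCountablePartition {X : Type*} (E : ℕ → Set X) : Prop :=
  (∀ i, (E i).Nonempty) ∧ (Pairwise fun i j => Disjoint (E i) (E j)) ∧ (⋃ i, E i) = Set.univ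

/-- A finite partition of `X` indexed by `Fin m`. -/
def IsFinitePartition {X : Type*} {m : ℕ} (E : Fin m → Set X) : Prop :=
  (∀ i, (E i).Nonempty) ∧ (Pairwise fun i j => Disjoint (E i) (E j)) ∧ (⋃ i, E i) = Set.univ

/-- `Con_c(𝔤, ℰ; X)`: the set of countable-configurations corresponding to the
countable-configuration pair `(g, E)`. A configuration `C = (C_0, C_1, …)` belongs to it iff
there is `x ∈ E (C 0)` with `g i • x ∈ E (C (i+1))` for all `i` (here `g i` plays the role of
`g_{i+1}` and `C (i+1)` of `C_{i+1}`). -/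
def countableConfigSet (G X : Type*) [Group G] [MulAction G X]
    (g : ℕ → G) (E : ℕ → Set X) : Set (ℕ → ℕ) :=
  {C | ∃ x ∈ E (C 0), ∀ i, g i • x ∈ E (C (i + 1))}

/-- `Con_c(G ↷ X)`: the family of all countable-configuration sets of the action. -/
def countableConfigFamily (G X : Type*) [Group G] [MulAction G X] : Set (Set (ℕ → ℕ)) :=
  {S | ∃ (g : ℕ → G) (E : ℕ → Set X), IsCountablePartition E ∧ S = countableConfigSet G X g E}

/-- `Con(𝔤, ℰ; X)`: the set of finite configurations for a tuple `g : Fin n → G` and a finite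
partition `E : Fin m → Set X`. -/
def finiteConfigSet (G X : Type*) [Group G] [MulAction G X] {n m : ℕ}
    (g : Fin n → G) (E : Fin m → Set X) : Set (Fin (n + 1) → Fin m) :=
  {C | ∃ x ∈ E (C 0), ∀ j : Fin n, g j • x ∈ E (C j.succ)}

/-- `Con(G ↷ X)`: the family of all finite configuration sets of the action, packaged with the
lengths `n` (of the tuple of group elements) and `m` (of the partition). -/
def finiteConfigFamily (G X : Type*) [Group G] [MulAction G X] :
    Set (Σ n : ℕ, Σ m : ℕ, Set (Fin (n + 1) → Fin m)) :=
  {p | ∃ (g : Fin p.1 → G) (E : Fin p.2.1 → Set X),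
    IsFinitePartition E ∧ p.2.2 = finiteConfigSet G X g E}

/-- Merging the parts of a countable partition along a surjection onto `Fin m` gives a finite
partition. -/
theorem IsCountablePartition.merge {X : Type*} {E : ℕ → Set X} (hE : IsCountablePartition E)
    {m : ℕ} {f : ℕ → Fin m} (hf : Function.Surjective f) :
    IsFinitePartition fun j => {x | ∃ k, f k = j ∧ x ∈ E k} := by
  obtain ⟨hne, hdisj, hcov⟩ := hE
  refine ⟨fun j => ?_, fun i j hij => ?_, ?_⟩
  · obtain ⟨k, hk⟩ := hf j
    obtain ⟨x, hx⟩ := hne k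
    exact ⟨x, k, hk, hx⟩
  · refine Set.disjoint_left.2 ?_
    rintro x ⟨k, rfl, hk⟩ ⟨l, rfl, hl⟩
    have hkl : k ≠ l := fun h => hij (congrArg f h)
    exact Set.disjoint_left.1 (hdisj hkl) hk hl
  · refine Set.eq_univ_of_forall fun x => ?_
    obtain ⟨k, hk⟩ := Set.mem_iUnion.1 (hcov ▸ Set.mem_univ x)
    exact Set.mem_iUnion.2 ⟨f k, k, rfl, hk⟩

/-- The finite configurations of a merged partition are the truncated images of the
countable configurations. -/
theorem finiteConfigSet_merge {G X : Type*} [Group G] [MulAction G X] (g : ℕ → G)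
    {E : ℕ → Set X} (hE : ⋃ i, E i = Set.univ) (n : ℕ) {m : ℕ} (f : ℕ → Fin m) :
    finiteConfigSet G X (fun i : Fin n => g i) (fun j => {x | ∃ k, f k = j ∧ x ∈ E k}) =
      (fun (C : ℕ → ℕ) (i : Fin (n + 1)) => f (C i)) '' countableConfigSet G X g E := by
  have hcov : ∀ x, ∃ k, x ∈ E k := fun x => Set.mem_iUnion.1 (hE ▸ Set.mem_univ x)
  choose p hp using hcov
  ext C
  constructor
  · rintro ⟨x, ⟨k₀, hk₀, hx⟩, hC⟩
    choose k hk hkx using hC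
    let D : ℕ → ℕ
      | 0 => k₀
      | i + 1 => if hi : i < n then k ⟨i, hi⟩ else p (g i • x)
    refine ⟨D, ⟨x, hx, fun i => ?_⟩, funext fun i => ?_⟩
    · by_cases hi : i < n
      · simpa [D, hi] using hkx ⟨i, hi⟩
      · simpa [D, hi] using hp (g i • x)
    · cases i using Fin.cases with
      | zero => exact hk₀
      | succ i => simpa [D] using hk i
  · rintro ⟨D, ⟨x, hx, hD⟩, rfl⟩
    exact ⟨x, ⟨D 0, rfl, hx⟩, fun i => ⟨D (i + 1), by simp, hD i⟩⟩

/-- Every finite partition of an infinite set is obtained from a countable partition by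
merging parts. -/
theorem IsFinitePartition.exists_refinement {X : Type*} [Infinite X] {m : ℕ}
    {E : Fin m → Set X} (hE : IsFinitePartition E) :
    ∃ (E' : ℕ → Set X) (f : ℕ → Fin m), IsCountablePartition E' ∧ Function.Surjective f ∧
      E = fun j => {x | ∃ k, f k = j ∧ x ∈ E' k} := by
  obtain ⟨hne, hdisj, hcov⟩ := hE
  have hcov : ∀ x, ∃ j, x ∈ E j := fun x => Set.mem_iUnion.1 (hcov ▸ Set.mem_univ x)
  choose c hc using hcov
  have hc_eq : ∀ {x j}, x ∈ E j → c x = j := fun {x j} hx => by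
    by_contra hne
    exact Set.disjoint_left.1 (hdisj hne) (hc x) hx
  let φ : X → ℕ := Function.invFun (Infinite.natEmbedding X)
  have hφ : Function.Surjective φ :=
    Function.invFun_surjective (Infinite.natEmbedding X).injective
  let ψ : X → Fin m × ℕ := fun x => (c x, φ x)
  have : Infinite (Set.range ψ) :=
    Infinite.of_surjective (fun y : Set.range ψ => y.1.2) fun k => by
      obtain ⟨x, hx⟩ := hφ k
      exact ⟨⟨ψ x, x, rfl⟩, hx⟩
  obtain ⟨e⟩ : Nonempty (Set.range ψ ≃ ℕ) := nonempty_equiv_of_countable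
  let q : X → ℕ := fun x => e ⟨ψ x, x, rfl⟩
  let f : ℕ → Fin m := fun k => (e.symm k).1.1
  have hfq : ∀ x, f (q x) = c x := fun x => by simp [f, q, ψ]
  refine ⟨fun k => {x | q x = k}, f, ⟨fun k => ?_, fun i j hij => ?_, ?_⟩, fun j => ?_, ?_⟩
  · obtain ⟨x, hx⟩ := (e.symm k).2
    exact ⟨x, e.symm_apply_eq.1 (Subtype.ext hx.symm) |>.symm⟩
  · exact Set.disjoint_left.2 fun x hi hj => hij (hi.symm.trans hj)
  · exact Set.eq_univ_of_forall fun x => Set.mem_iUnion.2 ⟨q x, rfl⟩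
  · obtain ⟨x, hx⟩ := hne j
    exact ⟨q x, (hfq x).trans (hc_eq hx)⟩
  · ext j x
    constructor
    · exact fun hx => ⟨q x, (hfq x).trans (hc_eq hx), rfl⟩
    · rintro ⟨k, rfl, rfl⟩
      exact hfq x ▸ hc x

theorem finiteConfigFamily_subset {G H X Y : Type*} [Group G] [Group H]
    [MulAction G X] [MulAction H Y] [Infinite X]
    (h : countableConfigFamily G X ⊆ countableConfigFamily H Y) :
    finiteConfigFamily G X ⊆ finiteConfigFamily H Y := by
  rintro ⟨n, m, S⟩ ⟨g, E, hE, hS⟩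
  dsimp only at g E hE hS
  obtain ⟨E', f, hE', hf, rfl⟩ := hE.exists_refinement
  let g' : ℕ → G := fun i => if hi : i < n then g ⟨i, hi⟩ else 1
  have hg : g = fun i : Fin n => g' i := by
    funext i
    simp [g']
  obtain ⟨k, F, hF, hEF⟩ := h ⟨g', E', hE', rfl⟩
  refine ⟨fun i : Fin n => k i, fun j => {y | ∃ l, f l = j ∧ y ∈ F l}, hF.merge hf, ?_⟩
  dsimp only
  rw [hS, hg, finiteConfigSet_merge g' hE'.2.2, finiteConfigSet_merge k hF.2.2, hEF]

/-- If two actions of countable groups on infinite sets have the same family of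
countable-configurations, then they have the same family of finite configurations. -/
theorem config_of_countableConfig {G H X Y : Type*} [Group G] [Group H]
    [Countable G] [Countable H] [MulAction G X] [MulAction H Y]
    [Infinite X] [Infinite Y]
    (h : countableConfigFamily G X = countableConfigFamily H Y) :
    finiteConfigFamily G X = finiteConfigFamily H Y := by
  exact (finiteConfigFamily_subset h.subset).antisymm (finiteConfigFamily_subset h.symm.subset)
end

section
/- Every countably infinite group G is countably paradoxical. -/
open Pointwise

/-- A subset `S` of a `G`-set `X` is countably `G`-paradoxical: there are countably many
pairwise disjoint subsets `A i`, `B i` of `S` whose union is `S`, and group elements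
`g i`, `h i`, such that the translates `g i • A i` are pairwise disjoint with union `S`,
and likewise the translates `h i • B i`. -/
def CountablyParadoxicalSet (G : Type*) [Group G] {X : Type*} [MulAction G X]
    (S : Set X) : Prop :=
  ∃ (A B : ℕ → Set X) (g h : ℕ → G),
    (∀ i, A i ⊆ S) ∧ (∀ i, B i ⊆ S) ∧
    (Pairwise fun i j => Disjoint (A i) (A j)) ∧
    (Pairwise fun i j => Disjoint (B i) (B j)) ∧
    (∀ i j, Disjoint (A i) (B j)) ∧
    ((⋃ i, A i) ∪ (⋃ i, B i)) = S ∧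
    (Pairwise fun i j => Disjoint (g i • A i) (g j • A j)) ∧
    (⋃ i, g i • A i) = S ∧
    (Pairwise fun i j => Disjoint (h i • B i) (h j • B j)) ∧
    (⋃ i, h i • B i) = S

/-- An action `G ↷ X` is countably paradoxical if `X` (as a subset of itself) admits a
countable `G`-paradoxical decomposition. -/
def CountablyParadoxicalAction (G X : Type*) [Group G] [MulAction G X] : Prop :=
  CountablyParadoxicalSet G (Set.univ : Set X)

/-- A group is countably paradoxical if its action on itself by left multiplication is. -/
def CountablyParadoxicalGroup (G : Type*) [Group G] : Prop :=
  CountablyParadoxicalAction G G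

/-- Every countably infinite group is countably paradoxical. -/
theorem countablyParadoxical_of_countable_infinite (G : Type*) [Group G]
    [Countable G] [Infinite G] : CountablyParadoxicalGroup G := by
  obtain ⟨f⟩ : Nonempty (ℕ ≃ G) := nonempty_equiv_of_countable
  obtain ⟨e⟩ : Nonempty (ℕ ⊕ ℕ ≃ G) := nonempty_equiv_of_countable
  have smul_singleton_eq (x y : G) : (y * x⁻¹) • ({x} : Set G) = {y} := by
    simp [Set.smul_set_singleton]
  have union_f : (⋃ i, ({f i} : Set G)) = Set.univ := by
    rw [Set.iUnion_singleton_eq_range, f.range_eq_univ]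
  have disjoint_f : Pairwise fun i j => Disjoint ({f i} : Set G) {f j} := fun i j hij => by
    simpa using hij
  refine ⟨fun i => {e (.inl i)}, fun i => {e (.inr i)}, fun i => f i * (e (.inl i))⁻¹,
    fun i => f i * (e (.inr i))⁻¹, fun _ => Set.subset_univ _, fun _ => Set.subset_univ _,
    fun i j hij => by simpa using hij, fun i j hij => by simpa using hij,
    fun i j => by simp, ?_, ?_, ?_, ?_, ?_⟩
  · rw [Set.iUnion_singleton_eq_range, Set.iUnion_singleton_eq_range, Set.eq_univ_iff_forall]
    intro x
    obtain ⟨i | i, rfl⟩ := e.surjective x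
    · exact .inl ⟨i, rfl⟩
    · exact .inr ⟨i, rfl⟩
  all_goals simpa only [smul_singleton_eq]
end

section
/- If a group G has a subgroup H that is countably paradoxical (with respect to the action of H on itself by left multiplication), then G itself is countably paradoxical. -/
open Pointwise

/-- Countable paradoxicality pulls back along equivariant maps. -/
theorem CountablyParadoxicalSet.preimage {G X Y : Type*} [Group G] [MulAction G X]
    [MulAction G Y] {S : Set Y} (hS : CountablyParadoxicalSet G S) (f : X →[G] Y) :
    CountablyParadoxicalSet G (f ⁻¹' S) := by
  obtain ⟨A, B, g, h, hAS, hBS, hA, hB, hAB, hU, hgA, hgU, hhB, hhU⟩ := hS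
  have key (k : G) (C : Set Y) : k • (f ⁻¹' C) = f ⁻¹' (k • C) := by
    ext x
    simp [Set.mem_smul_set_iff_inv_smul_mem, map_smul]
  refine ⟨fun i => f ⁻¹' A i, fun i => f ⁻¹' B i, g, h, fun i => Set.preimage_mono (hAS i),
    fun i => Set.preimage_mono (hBS i), fun i j hij => (hA hij).preimage f,
    fun i j hij => (hB hij).preimage f, fun i j => (hAB i j).preimage f, ?_, ?_, ?_, ?_, ?_⟩
  · rw [← hU, Set.preimage_union, Set.preimage_iUnion, Set.preimage_iUnion]
  · simp only [key]
    exact fun i j hij => (hgA hij).preimage f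
  · simp only [key, ← Set.preimage_iUnion, hgU]
  · simp only [key]
    exact fun i j hij => (hhB hij).preimage f
  · simp only [key, ← Set.preimage_iUnion, hhU]

/-- A set that is countably paradoxical for a subgroup is so for the whole group. -/
theorem CountablyParadoxicalSet.of_subgroup {G X : Type*} [Group G] [MulAction G X]
    {H : Subgroup G} {S : Set X} (hS : CountablyParadoxicalSet H S) :
    CountablyParadoxicalSet G S := by
  obtain ⟨A, B, g, h, hS⟩ := hS
  exact ⟨A, B, fun i => g i, fun i => h i, hS⟩

/-- If a group has a countably paradoxical subgroup, then it is countably paradoxical. -/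
theorem countablyParadoxical_of_subgroup {G : Type*} [Group G] (H : Subgroup G)
    (hH : CountablyParadoxicalGroup H) : CountablyParadoxicalGroup G := by
  obtain ⟨T, hT, -⟩ := H.exists_isComplement_right 1
  let f : G →[H] H :=
    { toFun := fun x => (hT.equiv x).1
      map_smul' := fun k x => congrArg Prod.fst (hT.equiv_mul_left k x) }
  exact (CountablyParadoxicalSet.preimage hH f).of_subgroup
end

section
/- A group G is countably paradoxical if and only if G is infinite. -/
open Pointwise

/-- On a finite `G`-set, pairwise disjoint sets whose translates cover everything
already cover everything. -/
theorem iUnion_eq_univ_of_iUnion_smul_eq_univ {G X ι : Type*} [Group G] [MulAction G X]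
    [Finite X] {A : ι → Set X} {g : ι → G}
    (hA : Pairwise fun i j => Disjoint (A i) (A j)) (hg : (⋃ i, g i • A i) = Set.univ) :
    (⋃ i, A i) = Set.univ := by
  have hcover : ∀ x : X, ∃ i, (g i)⁻¹ • x ∈ A i := fun x => by
    have hx : x ∈ ⋃ i, g i • A i := hg ▸ Set.mem_univ x
    simpa only [Set.mem_iUnion, Set.mem_smul_set_iff_inv_smul_mem] using hx
  choose k hk using hcover
  have hinj : Function.Injective fun x => (g (k x))⁻¹ • x := fun x y hxy => by
    have hxy' : (g (k x))⁻¹ • x = (g (k y))⁻¹ • y := hxy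
    have hkxy : k x = k y := by
      by_contra hne
      exact Set.disjoint_left.mp (hA hne) (hk x) (hxy' ▸ hk y)
    rw [hkxy] at hxy'
    exact MulAction.injective _ hxy'
  refine Set.eq_univ_of_forall fun y => ?_
  obtain ⟨x, rfl⟩ := Finite.surjective_of_injective hinj y
  exact Set.mem_iUnion.mpr ⟨k x, hk x⟩

theorem not_countablyParadoxicalAction_of_finite (G X : Type*) [Group G] [MulAction G X]
    [Finite X] [Nonempty X] : ¬ CountablyParadoxicalAction G X := by
  rintro ⟨A, B, g, h, -, -, hA, hB, hAB, -, -, hgA, -, hhB⟩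
  obtain ⟨x⟩ := ‹Nonempty X›
  have hxA : x ∈ ⋃ i, A i := iUnion_eq_univ_of_iUnion_smul_eq_univ hA hgA ▸ Set.mem_univ x
  have hxB : x ∈ ⋃ i, B i := iUnion_eq_univ_of_iUnion_smul_eq_univ hB hhB ▸ Set.mem_univ x
  obtain ⟨i, hi⟩ := Set.mem_iUnion.mp hxA
  obtain ⟨j, hj⟩ := Set.mem_iUnion.mp hxB
  exact Set.disjoint_left.mp (hAB i j) hi hj

/-- A `G`-set partitioned into countably infinitely many translates of one set is countably
paradoxical: split the translates into those of even and those of odd index. -/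
theorem countablyParadoxicalAction_of_partition_translates {G X : Type*} [Group G]
    [MulAction G X] {c : ℕ → G} {T : Set X}
    (hdisj : Pairwise fun i j => Disjoint (c i • T) (c j • T))
    (hcover : (⋃ i, c i • T) = Set.univ) : CountablyParadoxicalAction G X := by
  have hmove : ∀ i j, (c i * (c j)⁻¹) • c j • T = c i • T := fun i j => by
    rw [smul_smul, inv_mul_cancel_right]
  refine ⟨fun i => c (2 * i) • T, fun i => c (2 * i + 1) • T,
    fun i => c i * (c (2 * i))⁻¹, fun i => c i * (c (2 * i + 1))⁻¹,
    fun _ => Set.subset_univ _, fun _ => Set.subset_univ _,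
    fun i j hij => hdisj (by lia), fun i j hij => hdisj (by lia),
    fun i j => hdisj (by lia), ?_, ?_, ?_, ?_, ?_⟩
  · refine Set.eq_univ_of_forall fun x => ?_
    have hx : x ∈ ⋃ i, c i • T := hcover ▸ Set.mem_univ x
    obtain ⟨n, hn⟩ := Set.mem_iUnion.mp hx
    obtain ⟨m, rfl | rfl⟩ := n.even_or_odd'
    · exact Or.inl (Set.mem_iUnion.mpr ⟨m, hn⟩)
    · exact Or.inr (Set.mem_iUnion.mpr ⟨m, hn⟩)
  all_goals simpa only [hmove]

theorem exists_subgroup_countable_infinite (G : Type*) [Group G] [Infinite G] :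
    ∃ H : Subgroup G, Countable H ∧ Infinite H := by
  let f := FreeGroup.lift (Infinite.natEmbedding G)
  have : Countable (FreeGroup ℕ) := (Quot.mk_surjective (r := FreeGroup.Red.Step)).countable
  refine ⟨f.range, f.rangeRestrict_surjective.countable,
    Infinite.of_injective (fun n => f.rangeRestrict (FreeGroup.of n)) fun m n hmn => ?_⟩
  simpa [f, Subtype.ext_iff] using hmn

theorem countablyParadoxicalGroup_of_infinite (G : Type*) [Group G] [Infinite G] :
    CountablyParadoxicalGroup G := by
  obtain ⟨H, _, _⟩ := exists_subgroup_countable_infinite G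
  obtain ⟨e⟩ := nonempty_equiv_of_countable (α := ℕ) (β := H)
  obtain ⟨T, hT, -⟩ := H.exists_isComplement_right 1
  refine countablyParadoxicalAction_of_partition_translates (c := fun n => (e n : G)) (T := T)
    (fun i j hij => Set.disjoint_left.mpr ?_) (Set.eq_univ_of_forall fun x => ?_)
  · rintro _ ⟨t, ht, rfl⟩ ⟨u, hu, hut⟩
    have heq : ((e j, ⟨u, hu⟩) : H × T) = (e i, ⟨t, ht⟩) := hT.1 hut
    exact hij (e.injective (Prod.ext_iff.mp heq).1).symm
  · obtain ⟨⟨h, t⟩, rfl⟩ := hT.2 x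
    obtain ⟨n, rfl⟩ := e.surjective h
    exact Set.mem_iUnion.mpr ⟨n, t, t.2, rfl⟩

/-- A group is countably paradoxical if and only if it is infinite. -/
theorem countablyParadoxical_iff_infinite (G : Type*) [Group G] :
    CountablyParadoxicalGroup G ↔ Infinite G := by
  refine ⟨fun hG => ?_, fun _ => countablyParadoxicalGroup_of_infinite G⟩
  by_contra hfin
  have := not_infinite_iff_finite.mp hfin
  exact not_countablyParadoxicalAction_of_finite G G hG
end

section
/- If a group G is not countably paradoxical (equivalently, by Theorem 3.3, if G is finite), then no action of G on a nonempty set X is countably paradoxical. -/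
open Pointwise

/-- Countable paradoxical decompositions pull back along equivariant maps. -/
theorem CountablyParadoxicalAction.of_equivariant {G X Y : Type*} [Group G] [MulAction G X]
    [MulAction G Y] (f : Y →[G] X) (hX : CountablyParadoxicalAction G X) :
    CountablyParadoxicalAction G Y := by
  obtain ⟨A, B, g, h, -, -, hA, hB, hAB, hU, hgA, hgU, hhB, hhU⟩ := hX
  have smul_preimage (c : G) (S : Set X) : c • (f ⁻¹' S) = f ⁻¹' (c • S) := by
    ext y
    simp [Set.mem_smul_set_iff_inv_smul_mem]
  refine ⟨fun i => f ⁻¹' A i, fun i => f ⁻¹' B i, g, h, fun _ => Set.subset_univ _,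
    fun _ => Set.subset_univ _, fun i j hij => (hA hij).preimage f,
    fun i j hij => (hB hij).preimage f, fun i j => (hAB i j).preimage f, ?_, ?_, ?_, ?_, ?_⟩
  · rw [← Set.preimage_iUnion, ← Set.preimage_iUnion, ← Set.preimage_union, hU, Set.preimage_univ]
  · intro i j hij
    simpa only [smul_preimage] using (hgA hij).preimage f
  · simp only [smul_preimage, ← Set.preimage_iUnion, hgU, Set.preimage_univ]
  · intro i j hij
    simpa only [smul_preimage] using (hhB hij).preimage f
  · simp only [smul_preimage, ← Set.preimage_iUnion, hhU, Set.preimage_univ]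

/-- If a group is not countably paradoxical, then none of its actions on nonempty sets are
countably paradoxical. -/
theorem not_countablyParadoxicalAction {G : Type*} [Group G]
    (hG : ¬ CountablyParadoxicalGroup G)
    (X : Type*) [MulAction G X] [Nonempty X] :
    ¬ CountablyParadoxicalAction G X := by
  intro hX
  obtain ⟨x⟩ := ‹Nonempty X›
  let orbitMap : G →[G] X :=
    { toFun := (· • x)
      map_smul' := fun c y => mul_smul c y x }
  exact hG (.of_equivariant orbitMap hX)
end

section
/- Let a group G act on a set X such that the orbit space X/G is countably infinite. Then the action of G on X is countably paradoxical if and only if for every x ∈ X the orbit G·x (equivalently, via the G-equivariant bijection hG_x ↦ h·x, the coset space G/G_x of the stabilizer G_x) is a countably G-paradoxical subset of X. -/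
open Pointwise

/-- The intersection of a countably paradoxical set with an invariant set is countably
paradoxical. -/
theorem CountablyParadoxicalSet.inter_of_smul_eq {G X : Type*} [Group G] [MulAction G X]
    {S T : Set X} (hS : CountablyParadoxicalSet G S) (hT : ∀ g : G, g • T = T) :
    CountablyParadoxicalSet G (S ∩ T) := by
  obtain ⟨A, B, g, h, hA, hB, hAA, hBB, hAB, hU, hgA, hgU, hhB, hhU⟩ := hS
  have smul_inter (k : G) (C : Set X) : k • (C ∩ T) = k • C ∩ T := by
    rw [Set.smul_set_inter, hT]
  refine ⟨fun i => A i ∩ T, fun i => B i ∩ T, g, h,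
    fun i => Set.inter_subset_inter_left _ (hA i),
    fun i => Set.inter_subset_inter_left _ (hB i),
    fun i j hij => (hAA hij).mono Set.inter_subset_left Set.inter_subset_left,
    fun i j hij => (hBB hij).mono Set.inter_subset_left Set.inter_subset_left,
    fun i j => (hAB i j).mono Set.inter_subset_left Set.inter_subset_left, ?_, ?_, ?_, ?_, ?_⟩
  · rw [← Set.iUnion_inter, ← Set.iUnion_inter, ← Set.union_inter_distrib_right, hU]
  · intro i j hij
    simp only [smul_inter]
    exact (hgA hij).mono Set.inter_subset_left Set.inter_subset_left
  · simp only [smul_inter]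
    rw [← Set.iUnion_inter, hgU]
  · intro i j hij
    simp only [smul_inter]
    exact (hhB hij).mono Set.inter_subset_left Set.inter_subset_left
  · simp only [smul_inter]
    rw [← Set.iUnion_inter, hhU]

/-- Subdividing each member of a disjoint family of sets gives a disjoint family. -/
theorem Set.pairwise_disjoint_prod {ι κ X : Type*} {S : ι → Set X}
    (hS : Pairwise fun i j => Disjoint (S i) (S j)) {P : ι → κ → Set X}
    (hP : ∀ i, Pairwise fun k l => Disjoint (P i k) (P i l)) (hPS : ∀ i k, P i k ⊆ S i) :
    Pairwise fun p q : ι × κ => Disjoint (P p.1 p.2) (P q.1 q.2) := by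
  rintro ⟨i, k⟩ ⟨j, l⟩ hne
  obtain rfl | hij := eq_or_ne i j
  · exact hP i fun hkl => hne (Prod.ext rfl hkl)
  · exact (hS hij).mono (hPS i k) (hPS j l)

/-- A countable disjoint union of countably paradoxical sets is countably paradoxical. -/
theorem CountablyParadoxicalSet.iUnion {G X ι : Type*} [Group G] [MulAction G X]
    [Countable ι] [Nonempty ι] {S : ι → Set X}
    (hS : ∀ i, CountablyParadoxicalSet G (S i))
    (hd : Pairwise fun i j => Disjoint (S i) (S j)) :
    CountablyParadoxicalSet G (⋃ i, S i) := by
  choose A B g h hA hB hAA hBB hAB hU hgA hgU hhB hhU using hS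
  have hgS (i k) : g i k • A i k ⊆ S i :=
    (Set.subset_iUnion (fun k => g i k • A i k) k).trans (hgU i).subset
  have hhS (i k) : h i k • B i k ⊆ S i :=
    (Set.subset_iUnion (fun k => h i k • B i k) k).trans (hhU i).subset
  obtain ⟨e⟩ : Nonempty (ℕ ≃ ι × ℕ) := nonempty_equiv_of_countable
  have iUnion_eq (P : ι → ℕ → Set X) : ⋃ n, P (e n).1 (e n).2 = ⋃ i, ⋃ k, P i k := by
    rw [e.surjective.iUnion_comp (fun p => P p.1 p.2), Set.iUnion_prod']
  refine ⟨fun n => A (e n).1 (e n).2, fun n => B (e n).1 (e n).2,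
    fun n => g (e n).1 (e n).2, fun n => h (e n).1 (e n).2,
    fun n => (hA _ _).trans (Set.subset_iUnion S _),
    fun n => (hB _ _).trans (Set.subset_iUnion S _),
    (Set.pairwise_disjoint_prod hd hAA hA).comp_of_injective e.injective,
    (Set.pairwise_disjoint_prod hd hBB hB).comp_of_injective e.injective, ?_, ?_,
    (Set.pairwise_disjoint_prod hd hgA hgS).comp_of_injective e.injective, ?_,
    (Set.pairwise_disjoint_prod hd hhB hhS).comp_of_injective e.injective, ?_⟩
  · intro m n
    obtain hmn | hmn := eq_or_ne (e m).1 (e n).1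
    · simpa only [hmn] using hAB (e n).1 (e m).2 (e n).2
    · exact (hd hmn).mono (hA _ _) (hB _ _)
  · rw [iUnion_eq A, iUnion_eq B, ← Set.iUnion_union_distrib]
    exact Set.iUnion_congr hU
  · rw [iUnion_eq fun i k => g i k • A i k]
    exact Set.iUnion_congr hgU
  · rw [iUnion_eq fun i k => h i k • B i k]
    exact Set.iUnion_congr hhU

/-- If the orbit space `X/G` is countably infinite, then the action `G ↷ X` is countably
paradoxical if and only if every orbit `G • x` is a countably `G`-paradoxical subset of
`X`. -/
theorem countablyParadoxicalAction_iff_orbits {G X : Type*} [Group G] [MulAction G X]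
    [Countable (MulAction.orbitRel.Quotient G X)]
    [Infinite (MulAction.orbitRel.Quotient G X)] :
    CountablyParadoxicalAction G X ↔
      ∀ x : X, CountablyParadoxicalSet G (MulAction.orbit G x) := by
  constructor
  · intro hX x
    simpa only [Set.univ_inter] using
      hX.inter_of_smul_eq fun g => MulAction.smul_orbit g x
  · intro hO
    have hcover : ⋃ q : MulAction.orbitRel.Quotient G X, q.orbit = Set.univ :=
      Set.eq_univ_of_forall fun x =>
        Set.mem_iUnion.2 ⟨_, MulAction.orbitRel.Quotient.mem_orbit.2 rfl⟩
    rw [CountablyParadoxicalAction, ← hcover]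
    refine CountablyParadoxicalSet.iUnion (fun q => ?_) fun p q hpq => ?_
    · induction q using Quotient.inductionOn' with
      | h x => exact hO x
    · refine Set.disjoint_left.2 fun x hp hq => hpq ?_
      rw [← MulAction.orbitRel.Quotient.mem_orbit.1 hp, MulAction.orbitRel.Quotient.mem_orbit.1 hq]
end

section
/- Let a group G act on a set X, and suppose there exist fixed sequences (g_i)_{i∈ℕ} and (h_i)_{i∈ℕ} of elements of G such that for every x ∈ X the orbit G·x is countably G-paradoxical with respect to these translating elements; that is, for every x ∈ X there exist families (A_i^x)_{i∈ℕ} and (B_i^x)_{i∈ℕ} of subsets of G·x with G·x = (⨆_{i∈ℕ} A_i^x) ⊔ (⨆_{i∈ℕ} B_i^x) = ⨆_{i∈ℕ} g_i·A_i^x = ⨆_{i∈ℕ} h_i·B_i^x, all unions disjoint. Then the action of G on X is countably paradoxical. -/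
open Pointwise

/-- If there are fixed sequences of translating elements `(g i)` and `(h i)` with respect to
which every orbit is countably `G`-paradoxical, then the action is countably paradoxical. -/
theorem countablyParadoxicalAction_of_orbits_fixed_translates {G X : Type*} [Group G]
    [MulAction G X] (g h : ℕ → G)
    (horb : ∀ x : X, ∃ A B : ℕ → Set X,
      (∀ i, A i ⊆ MulAction.orbit G x) ∧ (∀ i, B i ⊆ MulAction.orbit G x) ∧
      (Pairwise fun i j => Disjoint (A i) (A j)) ∧
      (Pairwise fun i j => Disjoint (B i) (B j)) ∧
      (∀ i j, Disjoint (A i) (B j)) ∧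
      ((⋃ i, A i) ∪ (⋃ i, B i)) = MulAction.orbit G x ∧
      (Pairwise fun i j => Disjoint (g i • A i) (g j • A j)) ∧
      (⋃ i, g i • A i) = MulAction.orbit G x ∧
      (Pairwise fun i j => Disjoint (h i • B i) (h j • B j)) ∧
      (⋃ i, h i • B i) = MulAction.orbit G x) :
    CountablyParadoxicalAction G X := by
  choose A B _ _ hA hB hAB hU hgA hgU hhB hhU using horb
  let r : X → X := fun x => (Quotient.mk (MulAction.orbitRel G X) x).out
  have hr (k : G) (x : X) : r (k • x) = r x :=
    congrArg Quotient.out (Quotient.sound (MulAction.mem_orbit x k))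
  have hmem (x : X) : x ∈ MulAction.orbit G (r x) :=
    Setoid.symm' _ (Quotient.mk_out (s := MulAction.orbitRel G X) x)
  have hsmul (C : X → ℕ → Set X) (k : G) (i : ℕ) (x : X) :
      x ∈ k • {y | y ∈ C (r y) i} ↔ x ∈ k • C (r x) i := by
    simp only [Set.mem_smul_set_iff_inv_smul_mem, Set.mem_ofPred_eq, hr]
  refine ⟨fun i => {x | x ∈ A (r x) i}, fun i => {x | x ∈ B (r x) i}, g, h,
    fun _ => Set.subset_univ _, fun _ => Set.subset_univ _, ?_, ?_, ?_, ?_, ?_, ?_, ?_, ?_⟩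
  · exact fun i j hij => Set.disjoint_left.2 fun x hi hj =>
      Set.disjoint_left.1 (hA (r x) hij) hi hj
  · exact fun i j hij => Set.disjoint_left.2 fun x hi hj =>
      Set.disjoint_left.1 (hB (r x) hij) hi hj
  · exact fun i j => Set.disjoint_left.2 fun x hi hj =>
      Set.disjoint_left.1 (hAB (r x) i j) hi hj
  · refine Set.eq_univ_of_forall fun x => ?_
    have hx := hmem x
    rw [← hU] at hx
    simpa only [Set.mem_union, Set.mem_iUnion, Set.mem_ofPred_eq] using hx
  · exact fun i j hij => Set.disjoint_left.2 fun x hi hj =>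
      Set.disjoint_left.1 (hgA (r x) hij) ((hsmul A _ _ x).1 hi) ((hsmul A _ _ x).1 hj)
  · refine Set.eq_univ_of_forall fun x => ?_
    have hx := hmem x
    rw [← hgU] at hx
    simpa only [Set.mem_iUnion, hsmul] using hx
  · exact fun i j hij => Set.disjoint_left.2 fun x hi hj =>
      Set.disjoint_left.1 (hhB (r x) hij) ((hsmul B _ _ x).1 hi) ((hsmul B _ _ x).1 hj)
  · refine Set.eq_univ_of_forall fun x => ?_
    have hx := hmem x
    rw [← hhU] at hx
    simpa only [Set.mem_iUnion, hsmul] using hx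
end
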